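/- Let G be a group with a finite symmetric generating set S* (e ∉ S*), let |·|_* denote the associated word length and B_n = {g : |g|_* ≤ n} the balls, and write |B_n| = exp(f_V(n)). Assume there is a constant c > 0 such that |B_n| ≥ c·n² for all n ≥ 1. Let P be a probability measure on G with finite first moment, i.e. Σ_{g∈G} P(g)·|g|_* < ∞. Then there exists a constant L ∈ ℝ such that for every n ≥ 1, H(P^{(n)}) ≤ L + 4·f_V(⌈E|P^{(n)}|_*⌉), where E|P^{(n)}|_* = Σ_{g∈G} P^{(n)}(g)·|g|_* and ⌈·⌉ is the ceiling. -/

import Mathlib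

open scoped Classical

noncomputable section

/-- Word length of `g` with respect to the generating set `S`
(least `n` such that `g` is a product of `n` elements of `S`). -/
def wordLength {G : Type*} [Group G] (S : Set G) (g : G) : ℕ :=
  sInf {n | ∃ l : List G, (∀ x ∈ l, x ∈ S) ∧ l.length = n ∧ l.prod = g}

/-- The ball of radius `n` with respect to the generating set `S`. -/
def ball {G : Type*} [Group G] (S : Set G) (n : ℕ) : Set G :=
  {g | wordLength S g ≤ n}

/-- The lazy simple random walk measure `P = (1/2)(δ_e + U_S)`. -/
def lazyWalk {G : Type*} [Group G] (S : Finset G) : G → ℝ := fun g =>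
  (if g = 1 then (1 : ℝ) / 2 else 0) + (if g ∈ S then 1 / (2 * (S.card : ℝ)) else 0)

/-- The `n`-fold convolution power of a measure `P` (with `P^{(0)} = δ_e`). -/
def convPow {G : Type*} [Group G] (P : G → ℝ) : ℕ → G → ℝ
  | 0 => fun g => if g = 1 then 1 else 0
  | n + 1 => fun g => ∑' h : G, convPow P n h * P (h⁻¹ * g)

/-- The speed (expected word length) of the walk at time `n`. -/
def speed {G : Type*} [Group G] (S : Set G) (P : G → ℝ) (n : ℕ) : ℝ :=
  ∑' g : G, convPow P n g * (wordLength S g : ℝ)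

/-- The entropy of a measure `Q`, with the convention `0 · ln 0 = 0`. -/
def entropy {G : Type*} [Group G] (Q : G → ℝ) : ℝ :=
  -∑' g : G, Q g * Real.log (Q g)

/-- A real Hilbert space equipped with an isometric linear `G`-representation and
a cocycle for it: `b (x y) = λ(x) b(y) + b(x)`. -/
structure HilbertCocycle (G : Type*) [Group G] where
  space : Type
  [nacg : NormedAddCommGroup space]
  [ips : InnerProductSpace ℝ space]
  [complete : CompleteSpace space]
  rep : G →* (space ≃ₗᵢ[ℝ] space)
  cocycle : G → space
  cocycle_rel : ∀ x y : G, cocycle (x * y) = rep x (cocycle y) + cocycle x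

attribute [instance] HilbertCocycle.nacg HilbertCocycle.ips HilbertCocycle.complete

/-- The set of values at `x` of concave functions on `[0,∞)` dominating `f` on `ℕ`. -/
def concaveMajorants (f : ℕ → ℝ) (x : ℝ) : Set ℝ :=
  {y | ∃ h : ℝ → ℝ, ConcaveOn ℝ (Set.Ici 0) h ∧ (∀ k : ℕ, f k ≤ h k) ∧ y = h x}

/-- The concave hull of `f : ℕ → ℝ`: the pointwise infimum of concave majorants. -/
def concaveHull (f : ℕ → ℝ) (x : ℝ) : ℝ := sInf (concaveMajorants f x)

/-- The log-volume of the ball of radius `n`. -/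
def growthLog {G : Type*} [Group G] (S : Set G) (n : ℕ) : ℝ :=
  Real.log (Nat.card ↥(ball S n))

end

section WordLength

variable {G : Type*} [Group G] {S : Set G}

theorem wordLength_le_of_list {l : List G} (hl : ∀ x ∈ l, x ∈ S) :
    wordLength S l.prod ≤ l.length :=
  Nat.sInf_le ⟨l, hl, rfl, rfl⟩

theorem exists_list_length_eq_wordLength (hsym : ∀ s ∈ S, s⁻¹ ∈ S)
    (hgen : Subgroup.closure S = ⊤) (g : G) :
    ∃ l : List G, (∀ x ∈ l, x ∈ S) ∧ l.length = wordLength S g ∧ l.prod = g := by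
  have hne : {n | ∃ l : List G, (∀ x ∈ l, x ∈ S) ∧ l.length = n ∧ l.prod = g}.Nonempty := by
    have hg : g ∈ Submonoid.closure (S ∪ S⁻¹) := by
      rw [← Subgroup.closure_toSubmonoid, hgen]
      trivial
    obtain ⟨l, hl, hp⟩ := Submonoid.exists_list_of_mem_closure hg
    refine ⟨l.length, l, fun x hx => ?_, rfl, hp⟩
    rcases hl x hx with h | h
    · exact h
    · simpa using hsym _ h
  exact Nat.sInf_mem hne

theorem wordLength_mul_le (hsym : ∀ s ∈ S, s⁻¹ ∈ S) (hgen : Subgroup.closure S = ⊤) (x y : G) :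
    wordLength S (x * y) ≤ wordLength S x + wordLength S y := by
  obtain ⟨l, hl, hn, rfl⟩ := exists_list_length_eq_wordLength hsym hgen x
  obtain ⟨m, hm, hk, rfl⟩ := exists_list_length_eq_wordLength hsym hgen y
  rw [← hn, ← hk, ← List.prod_append, ← List.length_append]
  refine wordLength_le_of_list fun z hz => ?_
  rcases List.mem_append.1 hz with h | h
  exacts [hl z h, hm z h]

theorem wordLength_eq_zero (hsym : ∀ s ∈ S, s⁻¹ ∈ S) (hgen : Subgroup.closure S = ⊤) {g : G}
    (hg : wordLength S g = 0) : g = 1 := by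
  obtain ⟨l, -, hn, rfl⟩ := exists_list_length_eq_wordLength hsym hgen g
  rw [hg, List.length_eq_zero_iff] at hn
  simp [hn]

theorem one_mem_ball (n : ℕ) : (1 : G) ∈ ball S n := by
  have := wordLength_le_of_list (S := S) (l := []) (by simp)
  exact le_trans (by simpa using this) (Nat.zero_le n)

theorem mem_ball_of_mem {s : G} (hs : s ∈ S) {n : ℕ} (hn : 1 ≤ n) : s ∈ ball S n := by
  have := wordLength_le_of_list (S := S) (l := [s]) (by simpa using hs)
  exact le_trans (by simpa using this) hn

open scoped Pointwise in
theorem ball_add_subset (hsym : ∀ s ∈ S, s⁻¹ ∈ S) (hgen : Subgroup.closure S = ⊤) (a b : ℕ) :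
    ball S (a + b) ⊆ ball S a * ball S b := by
  intro g hg
  obtain ⟨l, hl, hn, rfl⟩ := exists_list_length_eq_wordLength hsym hgen g
  have hlen : l.length ≤ a + b := hn ▸ hg
  refine Set.mem_mul.2 ⟨(l.take a).prod, ?_, (l.drop a).prod, ?_, List.prod_take_mul_prod_drop l a⟩
  · exact (wordLength_le_of_list fun x hx => hl x (List.mem_of_mem_take hx)).trans
      (List.length_take_le _ _)
  · refine (wordLength_le_of_list fun x hx => hl x (List.mem_of_mem_drop hx)).trans ?_
    rw [List.length_drop]
    omega

theorem ball_finite (hS : S.Finite) (hsym : ∀ s ∈ S, s⁻¹ ∈ S) (hgen : Subgroup.closure S = ⊤)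
    (n : ℕ) : (ball S n).Finite := by
  have h0 : (ball S 0).Finite :=
    (Set.finite_singleton (1 : G)).subset fun g hg =>
      wordLength_eq_zero hsym hgen (Nat.le_zero.1 hg)
  have h1 : (ball S 1).Finite := by
    refine (hS.union h0).subset fun g hg => ?_
    rcases Nat.le_one_iff_eq_zero_or_eq_one.1 (show wordLength S g ≤ 1 from hg) with h | h
    · exact Or.inr h.le
    · obtain ⟨l, hl, hn, rfl⟩ := exists_list_length_eq_wordLength hsym hgen g
      obtain ⟨s, rfl⟩ := List.length_eq_one_iff.1 (hn.trans h)
      left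
      simpa using hl
  induction n with
  | zero => exact h0
  | succ n ih => exact (ih.mul h1).subset (ball_add_subset hsym hgen n 1)

theorem natCard_ball_mul_le (hS : S.Finite) (hsym : ∀ s ∈ S, s⁻¹ ∈ S)
    (hgen : Subgroup.closure S = ⊤) (N k : ℕ) :
    Nat.card (ball S (k * N)) ≤ Nat.card (ball S N) ^ k := by
  induction k with
  | zero =>
    have : ball S (0 * N) ⊆ {1} := fun g hg =>
      wordLength_eq_zero hsym hgen (Nat.le_zero.1 (by simpa [ball] using hg))
    simpa using Nat.card_mono (Set.finite_singleton (1 : G)) this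
  | succ k ih =>
    rw [Nat.succ_mul, pow_succ]
    refine (Nat.card_mono ((ball_finite hS hsym hgen _).mul (ball_finite hS hsym hgen _))
      (ball_add_subset hsym hgen (k * N) N)).trans ?_
    exact Set.natCard_mul_le.trans (Nat.mul_le_mul_right _ ih)

theorem two_le_natCard_ball (hS : S.Finite) (hS1 : (1 : G) ∉ S) (hSne : S.Nonempty)
    (hsym : ∀ s ∈ S, s⁻¹ ∈ S) (hgen : Subgroup.closure S = ⊤) {N : ℕ} (hN : 1 ≤ N) :
    2 ≤ Nat.card (ball S N) := by
  obtain ⟨s, hs⟩ := hSne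
  have : Finite (ball S N) := ball_finite hS hsym hgen N
  have : Nontrivial (ball S N) :=
    ⟨⟨1, one_mem_ball N⟩, ⟨s, mem_ball_of_mem hs hN⟩, fun h =>
      hS1 ((Subtype.mk.inj h).symm ▸ hs)⟩
  exact Finite.one_lt_card

/-- Annulus weights that decay twice as fast, on the logarithmic scale, as the volume bound
obtained from submultiplicativity have total mass at most one. -/
theorem sum_inv_natCard_ball_pow_le_one (hS : S.Finite) (hS1 : (1 : G) ∉ S) (hSne : S.Nonempty)
    (hsym : ∀ s ∈ S, s⁻¹ ∈ S) (hgen : Subgroup.closure S = ⊤) {N : ℕ} (hN : 1 ≤ N)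
    (F : Finset G) :
    ∑ g ∈ F, ((Nat.card (ball S N) : ℝ) ^ (2 * (wordLength S g / N + 1)))⁻¹ ≤ 1 := by
  set V : ℝ := (Nat.card (ball S N) : ℝ) with hV
  have hV2 : (2 : ℝ) ≤ V := by
    rw [hV]
    exact_mod_cast two_le_natCard_ball hS hS1 hSne hsym hgen hN
  have hV0 : 0 < V := by linarith
  set K := F.sup fun g => wordLength S g / N + 1
  have hmaps : ∀ g ∈ F, wordLength S g / N ∈ Finset.range K := fun g hg =>
    Finset.mem_range.2 (Finset.le_sup (f := fun g => wordLength S g / N + 1) hg)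
  rw [← Finset.sum_fiberwise_of_maps_to hmaps]
  have hcard : ∀ k, ((F.filter fun g => wordLength S g / N = k).card : ℝ) ≤ V ^ (k + 1) := by
    intro k
    have hsub : ((F.filter fun g => wordLength S g / N = k : Finset G) : Set G) ⊆
        ball S ((k + 1) * N) := by
      intro g hg
      simp only [Finset.coe_filter, Set.mem_ofPred_eq] at hg
      have := Nat.lt_mul_of_div_lt (show wordLength S g / N < k + 1 by omega) hN
      exact this.le
    have h := (Nat.card_mono (ball_finite hS hsym hgen _) hsub).trans
      (natCard_ball_mul_le hS hsym hgen N (k + 1))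
    rw [Nat.card_coe_set_eq, Set.ncard_coe_finset] at h
    rw [hV]
    exact_mod_cast h
  have hfib : ∀ k ∈ Finset.range K, ∑ g ∈ F with wordLength S g / N = k,
      (V ^ (2 * (wordLength S g / N + 1)))⁻¹ ≤ (1 / 2 : ℝ) ^ (k + 1) := by
    intro k _
    calc ∑ g ∈ F with wordLength S g / N = k, (V ^ (2 * (wordLength S g / N + 1)))⁻¹
        = ∑ g ∈ F with wordLength S g / N = k, (V ^ (2 * (k + 1)))⁻¹ :=
          Finset.sum_congr rfl fun g hg => by rw [(Finset.mem_filter.1 hg).2]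
      _ = ((F.filter fun g => wordLength S g / N = k).card : ℝ) * (V ^ (2 * (k + 1)))⁻¹ := by
          rw [Finset.sum_const, nsmul_eq_mul]
      _ ≤ V ^ (k + 1) * (V ^ (2 * (k + 1)))⁻¹ := by gcongr; exact hcard k
      _ = (1 / V) ^ (k + 1) := by
          rw [two_mul, pow_add V (k + 1), one_div, inv_pow, mul_inv,
            mul_inv_cancel_left₀ (by positivity)]
      _ ≤ (1 / 2 : ℝ) ^ (k + 1) := by gcongr
  refine (Finset.sum_le_sum hfib).trans ?_
  have hgeom : ∀ K : ℕ, ∑ k ∈ Finset.range K, (1 / 2 : ℝ) ^ (k + 1) = 1 - (1 / 2) ^ K := by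
    intro K
    induction K with
    | zero => simp
    | succ K ih => rw [Finset.sum_range_succ, ih]; ring
  rw [hgeom]
  have : (0 : ℝ) ≤ (1 / 2) ^ K := by positivity
  linarith

end WordLength

section Entropy

/-- The Gibbs inequality, with an upper bound `f` for `-log w` in place of `-log w`. -/
theorem entropy_le_tsum_mul {G : Type*} [Group G] {Q w f : G → ℝ} (hQ0 : ∀ g, 0 ≤ Q g)
    (hQ : HasSum Q 1) (hw0 : ∀ g, 0 < w g) (hw : Summable w) (hw1 : ∑' g, w g ≤ 1)
    (hwf : ∀ g, -Real.log (w g) ≤ f g) (hf0 : ∀ g, 0 ≤ f g)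
    (hQf : Summable fun g => Q g * f g) :
    entropy Q ≤ ∑' g, Q g * f g := by
  by_cases hs : Summable fun g => Q g * Real.log (Q g)
  · have key : ∀ g, -(Q g * Real.log (Q g)) ≤ Q g * f g + (w g - Q g) := by
      intro g
      rcases (hQ0 g).eq_or_lt with h | h
      · simp [← h, (hw0 g).le]
      · have h1 := Real.log_le_sub_one_of_pos (div_pos (hw0 g) h)
        rw [Real.log_div (hw0 g).ne' h.ne'] at h1
        have h2 := mul_le_mul_of_nonneg_left h1 h.le
        have h3 : Q g * (w g / Q g - 1) = w g - Q g := by field_simp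
        have h4 := mul_le_mul_of_nonneg_left (hwf g) h.le
        linarith
    have h := hs.neg.tsum_le_tsum key (hQf.add (hw.sub hQ.summable))
    rw [hQf.tsum_add (hw.sub hQ.summable), hw.tsum_sub hQ.summable, tsum_neg, hQ.tsum_eq] at h
    unfold entropy
    linarith
  · rw [entropy, tsum_eq_zero_of_not_summable hs, neg_zero]
    exact tsum_nonneg fun g => mul_nonneg (hQ0 g) (hf0 g)

variable {G : Type*} [Group G] {S : Set G}

theorem entropy_le_four_mul_growthLog (hS : S.Finite) (hS1 : (1 : G) ∉ S) (hSne : S.Nonempty)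
    (hsym : ∀ s ∈ S, s⁻¹ ∈ S) (hgen : Subgroup.closure S = ⊤) {Q : G → ℝ} (hQ0 : ∀ g, 0 ≤ Q g)
    (hQ : HasSum Q 1) (hmom : Summable fun g => Q g * (wordLength S g : ℝ)) :
    entropy Q ≤ 4 * growthLog S ⌈∑' g, Q g * (wordLength S g : ℝ)⌉₊ := by
  set m := ∑' g, Q g * (wordLength S g : ℝ) with hm
  have hterm : ∀ g, 0 ≤ Q g * (wordLength S g : ℝ) := fun g =>
    mul_nonneg (hQ0 g) (Nat.cast_nonneg _)
  have hlog : 0 ≤ growthLog S ⌈m⌉₊ := Real.log_natCast_nonneg _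
  rcases (tsum_nonneg hterm : 0 ≤ m).eq_or_lt with hm0 | hm0
  · have hz : ∀ g, g ≠ 1 → Q g = 0 := by
      intro g hg
      have h0 : HasSum (fun g => Q g * (wordLength S g : ℝ)) 0 := hm0 ▸ hmom.hasSum
      have h := congrFun ((hasSum_zero_iff_of_nonneg hterm).1 h0) g
      refine (mul_eq_zero.1 h).resolve_right fun h' => hg ?_
      exact wordLength_eq_zero hsym hgen (Nat.cast_eq_zero.1 h')
    have h1 : Q 1 = 1 := by rw [← hQ.tsum_eq, tsum_eq_single 1 hz]
    have : entropy Q = 0 := by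
      rw [entropy, tsum_eq_single 1 fun g hg => by simp [hz g hg], h1]
      simp
    rw [this]
    positivity
  · set N := ⌈m⌉₊ with hN
    have hN1 : 1 ≤ N := Nat.ceil_pos.2 hm0
    have hmN : m / N ≤ 1 := div_le_one_of_le₀ (Nat.le_ceil m) (Nat.cast_nonneg _)
    set V : ℝ := (Nat.card (ball S N) : ℝ) with hV
    have hV2 : (2 : ℝ) ≤ V := by
      rw [hV]
      exact_mod_cast two_le_natCard_ball hS hS1 hSne hsym hgen hN1
    have hgl : growthLog S N = Real.log V := rfl
    set w : G → ℝ := fun g => (V ^ (2 * (wordLength S g / N + 1)))⁻¹ with hwdef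
    have hw0 : ∀ g, 0 < w g := fun g => by positivity
    have hfin : ∀ F : Finset G, ∑ g ∈ F, w g ≤ 1 :=
      sum_inv_natCard_ball_pow_le_one hS hS1 hSne hsym hgen hN1
    have hws : Summable w := summable_of_sum_le (fun g => (hw0 g).le) hfin
    have hw1 : ∑' g, w g ≤ 1 := hws.tsum_le_of_sum_le hfin
    have hsumf : HasSum (fun g => Q g * (2 * ((wordLength S g : ℝ) / N + 1) * Real.log V))
        (2 * Real.log V * (m / N) + 2 * Real.log V * 1) := by
      have h := ((hmom.hasSum.div_const (N : ℝ)).mul_left (2 * Real.log V)).add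
        (hQ.mul_left (2 * Real.log V))
      refine h.congr_fun fun g => ?_
      ring
    rw [hgl] at hlog ⊢
    refine (entropy_le_tsum_mul hQ0 hQ hw0 hws hw1 (fun g => ?_) (fun g => by positivity)
      hsumf.summable).trans ?_
    · rw [hwdef]
      simp only [Real.log_inv, Real.log_pow, neg_neg]
      push_cast
      gcongr
      exact Nat.cast_div_le
    · rw [hsumf.tsum_eq]
      nlinarith

end Entropy

section Convolution

variable {G : Type*} [Group G] {S : Set G} {P Q : G → ℝ}

/-- The change of variables `(g, h) ↦ (h, h⁻¹ g)`. -/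
def convEquiv (G : Type*) [Group G] : G × G ≃ G × G where
  toFun p := (p.2, p.2⁻¹ * p.1)
  invFun p := (p.1 * p.2, p.1)
  left_inv p := by simp
  right_inv p := by simp

theorem hasSum_conv (hQ0 : ∀ g, 0 ≤ Q g) (hP0 : ∀ g, 0 ≤ P g) {a b : ℝ} (hQ : HasSum Q a)
    (hP : HasSum P b) : HasSum (fun g => ∑' h, Q h * P (h⁻¹ * g)) (a * b) := by
  have hs : Summable fun p : G × G => Q p.1 * P p.2 :=
    hQ.summable.mul_of_nonneg hP.summable hQ0 hP0
  have h := (convEquiv G).hasSum_iff.2 (hQ.mul hP hs)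
  exact h.prod_fiberwise fun g => (h.summable.prod_factor g).hasSum

theorem summable_conv_mul_wordLength (hsym : ∀ s ∈ S, s⁻¹ ∈ S) (hgen : Subgroup.closure S = ⊤)
    (hQ0 : ∀ g, 0 ≤ Q g) (hP0 : ∀ g, 0 ≤ P g) (hQ : Summable Q) (hP : Summable P)
    (hQm : Summable fun g => Q g * (wordLength S g : ℝ))
    (hPm : Summable fun g => P g * (wordLength S g : ℝ)) :
    Summable fun g => (∑' h, Q h * P (h⁻¹ * g)) * (wordLength S g : ℝ) := by
  have h1 := hQm.mul_of_nonneg hP (fun g => mul_nonneg (hQ0 g) (Nat.cast_nonneg _)) hP0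
  have h2 := hQ.mul_of_nonneg hPm hQ0 (fun g => mul_nonneg (hP0 g) (Nat.cast_nonneg _))
  have h3 : Summable fun p : G × G => Q p.1 * P p.2 * (wordLength S (p.1 * p.2) : ℝ) := by
    refine Summable.of_nonneg_of_le
      (fun p => mul_nonneg (mul_nonneg (hQ0 _) (hP0 _)) (Nat.cast_nonneg _)) (fun p => ?_)
      (h1.add h2)
    have hle : (wordLength S (p.1 * p.2) : ℝ) ≤ wordLength S p.1 + wordLength S p.2 := by
      exact_mod_cast wordLength_mul_le hsym hgen p.1 p.2
    refine (mul_le_mul_of_nonneg_left hle (mul_nonneg (hQ0 _) (hP0 _))).trans (le_of_eq ?_)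
    ring
  have h4 := ((convEquiv G).summable_iff.2 h3).prod
  simpa [convEquiv, tsum_mul_right] using h4

theorem convPow_nonneg (hP0 : ∀ g, 0 ≤ P g) (n : ℕ) (g : G) : 0 ≤ convPow P n g := by
  induction n generalizing g with
  | zero => simp only [convPow]; split_ifs <;> norm_num
  | succ n ih => exact tsum_nonneg fun h => mul_nonneg (ih h) (hP0 _)

theorem hasSum_convPow (hP0 : ∀ g, 0 ≤ P g) (hP : HasSum P 1) (n : ℕ) :
    HasSum (convPow P n) 1 := by
  induction n with
  | zero => exact hasSum_ite_eq 1 1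
  | succ n ih => exact one_mul (1 : ℝ) ▸ hasSum_conv (convPow_nonneg hP0 n) hP0 ih hP

theorem summable_convPow_mul_wordLength (hsym : ∀ s ∈ S, s⁻¹ ∈ S)
    (hgen : Subgroup.closure S = ⊤) (hP0 : ∀ g, 0 ≤ P g) (hP : HasSum P 1)
    (hPm : Summable fun g => P g * (wordLength S g : ℝ)) (n : ℕ) :
    Summable fun g => convPow P n g * (wordLength S g : ℝ) := by
  induction n with
  | zero =>
    refine summable_of_ne_finset_zero (s := {1}) fun g hg => ?_
    simp [convPow, Finset.mem_singleton.not.1 hg]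
  | succ n ih =>
    exact summable_conv_mul_wordLength hsym hgen (convPow_nonneg hP0 n) hP0
      (hasSum_convPow hP0 hP n).summable hP.summable ih hPm

end Convolution

/-- if `|B_n| ≥ c n²` and `P` has finite first moment, then
`H(P^{(n)}) ≤ L + 4 f_V(⌈E|P^{(n)}|⌉)`. -/
theorem stmt14 {G : Type*} [Group G] (S : Finset G)
    (hS1 : (1 : G) ∉ S) (hSne : S.Nonempty) (hsym : ∀ s ∈ S, s⁻¹ ∈ S)
    (hgen : Subgroup.closure (S : Set G) = ⊤)
    (c : ℝ) (hc : 0 < c)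
    (hvol : ∀ n : ℕ, 1 ≤ n → c * (n : ℝ) ^ 2 ≤ (Nat.card ↥(ball (S : Set G) n) : ℝ))
    (P : G → ℝ) (hpos : ∀ g : G, 0 ≤ P g) (hsum : ∑' g : G, P g = 1)
    (hmom : Summable (fun g : G => P g * (wordLength (S : Set G) g : ℝ))) :
    ∃ L : ℝ, ∀ n : ℕ, 1 ≤ n →
      entropy (convPow P n) ≤
        L + 4 * growthLog (S : Set G) ⌈speed (S : Set G) P n⌉₊ := by
  have hP : HasSum P 1 := by
    have hs : Summable P := by
      by_contra h
      rw [tsum_eq_zero_of_not_summable h] at hsum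
      exact zero_ne_one hsum
    exact hsum ▸ hs.hasSum
  refine ⟨0, fun n _ => ?_⟩
  rw [zero_add]
  exact entropy_le_four_mul_growthLog S.finite_toSet (by simpa using hS1) (by simpa using hSne)
    hsym hgen (convPow_nonneg hpos n) (hasSum_convPow hpos hP n)
    (summable_convPow_mul_wordLength hsym hgen hpos hP hmom n)
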